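/- arXiv:0704.3683 — 6 statements merged into one kernel-verified Lean document; each statement's English description precedes it below -/
import Mathlib

section
/- Let j ≥ 1 and let R ⊆ (Fin j → ZMod 2) be affine-closed with R ≠ Set.univ. Suppose that for every index i : Fin j, the restriction map from R to ({l : Fin j // l ≠ i} → ZMod 2) (deleting coordinate i) is surjective. Then either R = {x : Fin j → ZMod 2 | ∑ l, x l = 0} or R = {x : Fin j → ZMod 2 | ∑ l, x l = 1}. -/
/-- A set `S` is affine-closed if it is closed under `a + b + c`. -/
def AffineClosed {α : Type*} [Add α] (S : Set α) : Prop :=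
  ∀ a ∈ S, ∀ b ∈ S, ∀ c ∈ S, a + b + c ∈ S

/-- If membership in `S` flips whenever one coordinate is flipped, then it is determined by parity. -/
theorem mem_iff_of_mem_add_single_iff {ι : Type*} [Fintype ι] [DecidableEq ι]
    {S : Set (ι → ZMod 2)} (hS : ∀ x i, x + Pi.single i 1 ∈ S ↔ x ∉ S) (x : ι → ZMod 2) :
    x ∈ S ↔ (∑ i, x i = 0 ↔ 0 ∈ S) := by
  have key (s : Finset ι) :
      ∑ i ∈ s, Pi.single i (x i) ∈ S ↔ (∑ i ∈ s, x i = 0 ↔ 0 ∈ S) := by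
    induction s using Finset.induction_on with
    | empty => simp
    | insert i s hi ih =>
      rw [Finset.sum_insert hi, Finset.sum_insert hi]
      have h01 : ∀ a : ZMod 2, a = 0 ∨ a = 1 := by decide
      rcases h01 (x i) with h | h
      · simpa [h] using ih
      · have flip : ∀ a : ZMod 2, 1 + a = 0 ↔ ¬ a = 0 := by decide
        rw [h, add_comm, hS, ih, flip]
        tauto
  simpa only [Finset.univ_sum_single] using key Finset.univ

/-- Two points of `ZMod 2`-space agreeing off `i` are equal or differ by the unit vector at `i`. -/
theorem eq_or_eq_add_single {ι : Type*} [DecidableEq ι] {x y : ι → ZMod 2} {i : ι}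
    (h : ∀ l : {l // l ≠ i}, x l.1 = y l.1) : x = y ∨ x = y + Pi.single i 1 := by
  have h01 : ∀ a b : ZMod 2, a = b ∨ a = b + 1 := by decide
  refine (h01 (x i) (y i)).imp (fun hi => ?_) (fun hi => ?_) <;> ext l <;>
    by_cases hl : l = i
  · rw [hl, hi]
  · exact h ⟨l, hl⟩
  · subst hl
    simp [hi]
  · simp [hl, h ⟨l, hl⟩]

/-- A proper affine-closed set with complete projections flips membership along coordinates. -/
theorem AffineClosed.add_single_mem_iff {ι : Type*} [DecidableEq ι] {R : Set (ι → ZMod 2)}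
    (hR : AffineClosed R) (hne : R ≠ Set.univ)
    (hsurj : ∀ i : ι, ∀ y : {l : ι // l ≠ i} → ZMod 2,
      ∃ x ∈ R, ∀ l : {l : ι // l ≠ i}, x l.1 = y l) (x : ι → ZMod 2) (i : ι) :
    x + Pi.single i 1 ∈ R ↔ x ∉ R := by
  constructor
  · refine fun hxi hx => hne (Set.eq_univ_of_forall fun y => ?_)
    obtain ⟨z, hz, hzy⟩ := hsurj i fun l => y l.1
    rcases eq_or_eq_add_single hzy with rfl | rfl
    · exact hz
    · convert hR _ hz _ hx _ hxi using 1
      have cancel : ∀ a b c : ZMod 2, a = a + b + c + (c + b) := by decide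
      ext l
      exact cancel _ _ _
  · intro hx
    obtain ⟨z, hz, hzx⟩ := hsurj i fun l => x l.1
    rcases eq_or_eq_add_single hzx with rfl | rfl
    · exact absurd hz hx
    · exact hz

theorem stmt4 (j : ℕ) (hj : 1 ≤ j) (R : Set (Fin j → ZMod 2)) (hR : AffineClosed R)
    (hne : R ≠ Set.univ)
    (hsurj : ∀ i : Fin j, ∀ y : {l : Fin j // l ≠ i} → ZMod 2,
      ∃ x ∈ R, ∀ l : {l : Fin j // l ≠ i}, x l.1 = y l) :
    R = {x : Fin j → ZMod 2 | ∑ l, x l = 0} ∨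
    R = {x : Fin j → ZMod 2 | ∑ l, x l = 1} := by
  have mem_iff := mem_iff_of_mem_add_single_iff (hR.add_single_mem_iff hne hsurj)
  have ne_zero_iff : ∀ a : ZMod 2, ¬ a = 0 ↔ a = 1 := by decide
  by_cases h0 : (0 : Fin j → ZMod 2) ∈ R
  · left
    ext x
    rw [mem_iff, Set.mem_ofPred_eq, iff_true_right h0]
  · right
    ext x
    rw [mem_iff, Set.mem_ofPred_eq, iff_false_right h0, ne_zero_iff]
end

section
/- Let V be a finite type, let G be a connected simple graph on V, fix v* ∈ V, and let λ : ℚ. Let C be the ZMod 2-linear span of the rows of the incidence matrix of G indexed by the vertices v ≠ v*, a finite set of vectors in Sym2 V → ZMod 2. For c ∈ C, let ‖c‖ denote the number of edges e of G with c e = 1. Then ∑_{c ∈ C} λ^{‖c‖} = (1/2) · ∑_{σ : V → ZMod 2} ∏_{e ∈ G.edgeFinset, e = s(u,v)} (if σ u = σ v then 1 else λ). -/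
namespace SimpleGraph

variable {V : Type*} [Fintype V] (G : SimpleGraph V)

open scoped Classical in
/-- The linear combination of the rows of the incidence matrix over `ZMod 2` with
coefficients `σ`, i.e. the indicator vector of the cut given by `σ`. -/
noncomputable def cutMap : (V → ZMod 2) →ₗ[ZMod 2] (Sym2 V → ZMod 2) :=
  Fintype.linearCombination (ZMod 2) fun v e => G.incMatrix (ZMod 2) v e

variable {G}

theorem cutMap_apply_of_adj {u v : V} (h : G.Adj u v) (σ : V → ZMod 2) :
    G.cutMap σ s(u, v) = σ u + σ v := by
  classical
  have hinc (w : V) : s(u, v) ∈ G.incidenceSet w ↔ w = u ∨ w = v := by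
    simp [incidenceSet, h]
  have hne := h.ne
  simp only [cutMap, Fintype.linearCombination_apply, Finset.sum_apply, Pi.smul_apply,
    incMatrix_apply', hinc, smul_eq_mul, mul_ite, mul_one, mul_zero]
  rw [← Finset.sum_filter, ← Finset.sum_pair hne]
  congr 1
  ext w
  simp

theorem cutMap_apply_of_notMem_edgeSet {e : Sym2 V} (h : e ∉ G.edgeSet) (σ : V → ZMod 2) :
    G.cutMap σ e = 0 := by
  classical
  have hinc (w : V) : e ∉ G.incidenceSet w := fun hw => h hw.1
  simp [cutMap, Fintype.linearCombination_apply, incMatrix_apply', hinc]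

theorem cutMap_apply_eq_one_iff {u v : V} (h : G.Adj u v) (σ : V → ZMod 2) :
    G.cutMap σ s(u, v) = 1 ↔ σ u ≠ σ v := by
  rw [cutMap_apply_of_adj h]
  generalize σ u = a
  generalize σ v = b
  decide +revert

theorem cutMap_const (a : ZMod 2) : G.cutMap (fun _ => a) = 0 := by
  ext e
  by_cases he : e ∈ G.edgeSet
  · induction e with
    | _ u v => simp [cutMap_apply_of_adj (G.mem_edgeSet.1 he), CharTwo.add_self_eq_zero]
  · exact cutMap_apply_of_notMem_edgeSet he _

theorem Connected.eq_zero_of_cutMap_eq_zero (hG : G.Connected) {σ : V → ZMod 2}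
    (h : G.cutMap σ = 0) {w : V} (hw : σ w = 0) : σ = 0 := by
  have hadj {u v : V} (huv : G.Adj u v) : σ u = σ v := by
    have := congrFun h s(u, v)
    rwa [cutMap_apply_of_adj huv, Pi.zero_apply, CharTwo.add_eq_zero] at this
  have hwalk {u v : V} (p : G.Walk u v) : σ u = σ v := by
    induction p with
    | nil => rfl
    | cons huv _ ih => exact (hadj huv).trans ih
  ext v
  obtain ⟨p⟩ := hG.preconnected v w
  exact (hwalk p).trans hw

open scoped Classical in
theorem range_cutMap (w : V) :
    LinearMap.range G.cutMap = Submodule.span (ZMod 2)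
      (Set.range fun v : {v : V // v ≠ w} => G.incMatrix (ZMod 2) v.1) := by
  apply le_antisymm
  · rintro _ ⟨σ, rfl⟩
    have h : G.cutMap σ = G.cutMap (σ - fun _ => σ w) := by
      rw [map_sub, cutMap_const, sub_zero]
    rw [h, cutMap, Fintype.linearCombination_apply]
    refine Submodule.sum_mem _ fun v _ => ?_
    by_cases hv : v = w
    · simp [hv]
    · exact Submodule.smul_mem _ _ (Submodule.subset_span ⟨⟨v, hv⟩, rfl⟩)
  · rw [Submodule.span_le]
    rintro _ ⟨v, rfl⟩
    exact ⟨Pi.single v.1 1, by simp [cutMap]⟩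

theorem Connected.bijective_cutMap_prod (hG : G.Connected) (w : V) :
    Function.Bijective fun σ : V → ZMod 2 => (σ w, G.cutMap.rangeRestrict σ) := by
  constructor
  · intro σ τ h
    simp only [Prod.mk.injEq] at h
    refine sub_eq_zero.1 (hG.eq_zero_of_cutMap_eq_zero (w := w) ?_ (sub_eq_zero.2 h.1))
    rw [map_sub, sub_eq_zero]
    exact congrArg Subtype.val h.2
  · rintro ⟨a, _, σ, rfl⟩
    refine ⟨σ + fun _ => a - σ w, ?_⟩
    ext1
    · simp
    · ext1
      simp [cutMap_const]

theorem Connected.sum_cutMap [DecidableEq V] {M : Type*} [AddCommMonoid M] (hG : G.Connected)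
    {C : Submodule (ZMod 2) (Sym2 V → ZMod 2)} [Fintype C] (hC : LinearMap.range G.cutMap = C)
    (f : (Sym2 V → ZMod 2) → M) :
    ∑ σ : V → ZMod 2, f (G.cutMap σ) = 2 • ∑ c : C, f c := by
  subst hC
  obtain ⟨w⟩ := hG.nonempty
  have h := (hG.bijective_cutMap_prod w).sum_comp
    fun p : ZMod 2 × LinearMap.range G.cutMap => f p.2
  simpa [Fintype.sum_prod_type] using h

open scoped Classical in
theorem prod_edgeFinset_eq_pow_card_cutMap {R : Type*} [CommMonoid R] (σ : V → ZMod 2) (x : R) :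
    ∏ e ∈ G.edgeFinset, Sym2.lift ⟨fun u v => if σ u = σ v then (1 : R) else x,
        fun _ _ => if_congr eq_comm rfl rfl⟩ e =
      x ^ (G.edgeFinset.filter fun e => G.cutMap σ e = 1).card := by
  rw [← Finset.prod_const, Finset.prod_filter]
  refine Finset.prod_congr rfl fun e he => ?_
  induction e with
  | _ u v =>
    simp [cutMap_apply_eq_one_iff (G.mem_edgeSet.1 (mem_edgeFinset.1 he)), ite_not]

end SimpleGraph

open scoped Classical in
theorem stmt7 (V : Type) [Fintype V] (G : SimpleGraph V) (hG : G.Connected)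
    (vstar : V) (lam : ℚ) :
    (∑ c : (Submodule.span (ZMod 2)
        (Set.range fun v : {v : V // v ≠ vstar} => G.incMatrix (ZMod 2) v.1)),
      lam ^ ((G.edgeFinset.filter fun e => (c : Sym2 V → ZMod 2) e = 1).card)) =
    (1 / 2) * ∑ σ : V → ZMod 2, ∏ e ∈ G.edgeFinset,
      Sym2.lift ⟨fun u v => if σ u = σ v then (1 : ℚ) else lam,
        fun u v => if_congr eq_comm rfl rfl⟩ e := by
  have hsum := hG.sum_cutMap (SimpleGraph.range_cutMap vstar) fun c =>
    lam ^ (G.edgeFinset.filter fun e => c e = 1).card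
  simp_rw [← SimpleGraph.prod_edgeFinset_eq_pow_card_cutMap] at hsum
  rw [nsmul_eq_mul] at hsum
  push_cast at hsum
  linarith
end

section
/- Let q ≥ 1, let V be a finite type, let t : Fin q → V be injective, and let w : (V → Fin q) → ℚ satisfy w (π ∘ σ) = w σ for every permutation π : Equiv.Perm (Fin q) and every σ : V → Fin q. Then ∑_{σ : V → Fin q, Function.Bijective (σ ∘ t)} w σ = q! · ∑_{σ : V → Fin q, ∀ i, σ (t i) = i} w σ. -/
open scoped Classical in
theorem stmt9 (q : ℕ) (hq : 1 ≤ q) (V : Type) [Fintype V]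
    (t : Fin q → V) (ht : Function.Injective t)
    (w : (V → Fin q) → ℚ)
    (hw : ∀ (π : Equiv.Perm (Fin q)) (σ : V → Fin q), w (⇑π ∘ σ) = w σ) :
    ∑ σ ∈ Finset.univ.filter (fun σ : V → Fin q => Function.Bijective (σ ∘ t)), w σ =
    (Nat.factorial q : ℚ) *
      ∑ σ ∈ Finset.univ.filter (fun σ : V → Fin q => ∀ i : Fin q, σ (t i) = i), w σ := by
  have hcard : (Finset.univ : Finset (Equiv.Perm (Fin q))).card = Nat.factorial q := by
    rw [Finset.card_univ, Fintype.card_perm, Fintype.card_fin]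
  rw [← hcard, ← nsmul_eq_mul, ← Finset.sum_const, ← Finset.sum_product']
  symm
  refine Finset.sum_nbij (fun p => ⇑p.1 ∘ p.2) ?_ ?_ ?_ (fun p _ => (hw p.1 p.2).symm)
  · rintro ⟨π, σ⟩ h
    have hσ : σ ∘ t = id := funext (by simpa using h)
    refine Finset.mem_filter.2 ⟨Finset.mem_univ _, ?_⟩
    rw [Function.comp_assoc, hσ]
    exact π.bijective
  · rintro ⟨π, σ⟩ h ⟨π', σ'⟩ h' heq
    have hσ : ∀ i, σ (t i) = i := by simpa using h
    have hσ' : ∀ i, σ' (t i) = i := by simpa using h'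
    have hπ : π = π' := by
      ext1 i
      simpa [hσ, hσ'] using congrFun heq (t i)
    subst hπ
    exact Prod.ext rfl (π.injective.comp_left heq)
  · intro σ h
    have hb : Function.Bijective (σ ∘ t) := (Finset.mem_filter.1 h).2
    let π := Equiv.ofBijective (σ ∘ t) hb
    refine ⟨(π, ⇑π.symm ∘ σ), ?_, ?_⟩
    · exact Finset.mem_coe.2 (Finset.mem_product.2 ⟨Finset.mem_univ _,
        Finset.mem_filter.2 ⟨Finset.mem_univ _, π.symm_apply_apply⟩⟩)
    · exact funext fun v => π.apply_symm_apply (σ v)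
end

section
/- Let q ≥ 1, let V be a finite type, let W : (V → Fin q) → ℚ, let k r : ℕ, let f : (Fin k → Fin q) → ℚ, let J : Fin r → Fin k be injective, and define the projection g : (Fin r → Fin q) → ℚ by g x = ∑_{x' : Fin k → Fin q, ∀ l, x' (J l) = x l} f x'. Let s : Fin r → V, let V' = V ⊕ {i : Fin k // i ∉ Set.range J}, and define s' : Fin k → V' by s' (J l) = Sum.inl (s l) for each l : Fin r and s' i = Sum.inr ⟨i, h⟩ for each i ∉ Set.range J. Then ∑_{τ : V' → Fin q} W (τ ∘ Sum.inl) · f (τ ∘ s') = ∑_{σ : V → Fin q} W σ · g (σ ∘ s). -/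
open scoped Classical in
theorem stmt11 (q : ℕ) (hq : 1 ≤ q) (V : Type) [Fintype V]
    (W : (V → Fin q) → ℚ) (k r : ℕ) (f : (Fin k → Fin q) → ℚ)
    (J : Fin r → Fin k) (hJ : Function.Injective J)
    (g : (Fin r → Fin q) → ℚ)
    (hg : ∀ x : Fin r → Fin q,
      g x = ∑ x' ∈ Finset.univ.filter
          (fun x' : Fin k → Fin q => ∀ l : Fin r, x' (J l) = x l), f x')
    (s : Fin r → V)
    (s' : Fin k → (V ⊕ {i : Fin k // i ∉ Set.range J}))
    (hs'1 : ∀ l : Fin r, s' (J l) = Sum.inl (s l))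
    (hs'2 : ∀ (i : Fin k) (h : i ∉ Set.range J), s' i = Sum.inr ⟨i, h⟩) :
    ∑ τ : (V ⊕ {i : Fin k // i ∉ Set.range J}) → Fin q,
        W (τ ∘ Sum.inl) * f (τ ∘ s') =
    ∑ σ : V → Fin q, W σ * g (σ ∘ s) := by
  rw [Fintype.sum_equiv (Equiv.sumArrowEquivProdArrow V {i : Fin k // i ∉ Set.range J} (Fin q))
    _ (fun p => W p.1 * f (Sum.elim p.1 p.2 ∘ s'))
    (fun τ => by
      have h : Sum.elim (τ ∘ Sum.inl) (τ ∘ Sum.inr) = τ := Sum.elim_comp_inl_inr τ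
      change _ = W (τ ∘ Sum.inl) * f (Sum.elim (τ ∘ Sum.inl) (τ ∘ Sum.inr) ∘ s')
      rw [h]),
    Fintype.sum_prod_type]
  refine Finset.sum_congr rfl fun σ _ => ?_
  dsimp only
  rw [← Finset.mul_sum, hg]
  congr 1
  refine Finset.sum_bij' (fun ρ _ => Sum.elim σ ρ ∘ s') (fun x' _ i => x' i) ?_ ?_ ?_ ?_ ?_
  · intro ρ _
    simp [hs'1]
  · intro x' _
    exact Finset.mem_univ _
  · intro ρ _
    funext i
    simp [hs'2 i i.2]
  · intro x' hx'
    have hx := (Finset.mem_filter.mp hx').2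
    funext i
    by_cases hi : i ∈ Set.range J
    · obtain ⟨l, rfl⟩ := hi
      simp [hs'1, hx l]
    · simp [hs'2 i hi]
  · intro ρ _
    rfl
end

section
/- Let V be a finite type with distinguished distinct elements t₀ ≠ t₁, and let W : (V → ZMod 2) → ℚ satisfy W (σ + 1) = W σ for every σ : V → ZMod 2, where σ + 1 denotes the pointwise flip v ↦ σ v + 1. Then (∑_{σ : V → ZMod 2} W σ) − (∑_{σ : V → ZMod 2, σ t₀ = σ t₁} W σ) = 2 · ∑_{σ : V → ZMod 2, σ t₀ = 0 ∧ σ t₁ = 1} W σ. -/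
open scoped Classical in
theorem stmt12 (V : Type) [Fintype V] (t₀ t₁ : V) (ht : t₀ ≠ t₁)
    (W : (V → ZMod 2) → ℚ)
    (hW : ∀ σ : V → ZMod 2, W (σ + 1) = W σ) :
    (∑ σ : V → ZMod 2, W σ) -
      (∑ σ ∈ Finset.univ.filter (fun σ : V → ZMod 2 => σ t₀ = σ t₁), W σ) =
    2 * ∑ σ ∈ Finset.univ.filter (fun σ : V → ZMod 2 => σ t₀ = 0 ∧ σ t₁ = 1), W σ := by
  have flip : ∑ σ : V → ZMod 2, (if σ t₀ = 1 ∧ σ t₁ = 0 then W σ else 0) =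
      ∑ σ : V → ZMod 2, (if σ t₀ = 0 ∧ σ t₁ = 1 then W σ else 0) := by
    refine Fintype.sum_equiv (Equiv.addRight 1) _ _ fun σ => ?_
    have key : ∀ a b : ZMod 2, (a = 1 ∧ b = 0) ↔ (a + 1 = 0 ∧ b + 1 = 1) := by decide
    simp only [Equiv.coe_addRight, hW, Pi.add_apply, Pi.one_apply, key]
  have split : ∀ σ : V → ZMod 2, W σ - (if σ t₀ = σ t₁ then W σ else 0) =
      (if σ t₀ = 0 ∧ σ t₁ = 1 then W σ else 0) +
        (if σ t₀ = 1 ∧ σ t₁ = 0 then W σ else 0) := by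
    intro σ
    have cases : ∀ a : ZMod 2, a = 0 ∨ a = 1 := by decide
    rcases cases (σ t₀) with h₀ | h₀ <;> rcases cases (σ t₁) with h₁ | h₁ <;> simp [h₀, h₁]
  rw [Finset.sum_filter, Finset.sum_filter, ← Finset.sum_sub_distrib,
    Finset.sum_congr rfl fun σ _ => split σ, Finset.sum_add_distrib, flip, two_mul]
end

section
/- Let k : ℕ and let f : (Fin k → ZMod 2) → ℚ. Suppose that for every index i : Fin k there exists λ i : ℚ such that for every y : Fin k → ZMod 2, f (Function.update y i 0) = λ i · f (Function.update y i 1). Then for every x : Fin k → ZMod 2, f x = f (fun _ => 1) · ∏_{i : Fin k, x i = 0} λ i; in particular f is a product of unary functions of its coordinates. -/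
/-- If switching any coordinate from `1` to `0` multiplies `f` by a constant depending only on that
coordinate, then switching all coordinates in `s` multiplies `f` by the product of the constants. -/
theorem apply_ite_mem_eq_mul_prod {ι α M : Type*} [DecidableEq ι] [Zero α] [One α] [CommMonoid M]
    (f : (ι → α) → M) (lam : ι → M)
    (h : ∀ i y, f (Function.update y i 0) = lam i * f (Function.update y i 1)) (s : Finset ι) :
    f (fun i => if i ∈ s then 0 else 1) = f (fun _ => 1) * ∏ i ∈ s, lam i := by
  induction s using Finset.induction_on with
  | empty => simp
  | insert a s ha ih =>
    have h0 : (fun i => if i ∈ insert a s then (0 : α) else 1) =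
        Function.update (fun i => if i ∈ s then 0 else 1) a 0 := by
      ext i
      by_cases hi : i = a <;> simp [hi]
    have h1 : Function.update (fun i => if i ∈ s then (0 : α) else 1) a 1 =
        fun i => if i ∈ s then 0 else 1 :=
      Function.update_eq_self_iff.2 (by simp [ha])
    rw [h0, h, h1, ih, Finset.prod_insert ha, mul_left_comm]

theorem stmt14 (k : ℕ) (f : (Fin k → ZMod 2) → ℚ) (lam : Fin k → ℚ)
    (h : ∀ (i : Fin k) (y : Fin k → ZMod 2),
      f (Function.update y i 0) = lam i * f (Function.update y i 1)) :
    ∀ x : Fin k → ZMod 2,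
      f x = f (fun _ => 1) * ∏ i ∈ Finset.univ.filter (fun i : Fin k => x i = 0), lam i := by
  intro x
  rw [← apply_ite_mem_eq_mul_prod f lam h]
  congr 1
  ext1 i
  have zero_or_one : ∀ a : ZMod 2, a = if a = 0 then 0 else 1 := by decide
  simpa using zero_or_one (x i)
end
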